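/- Extension of Watson's summation theorem: let a, b, c, d be complex numbers with Re(d) > 0 and Re(2c − a − b) > −1, such that (a+b+1)/2 and 2c+1 are not nonpositive integers, none of a, b is a nonpositive integer, and none of c − a/2 + 1/2, c − b/2 + 1/2, c − a/2 + 1, c − b/2 + 1 is a nonpositive integer. Then ₄F₃(a, b, c, d+1; (a+b+1)/2, 2c+1, d; 1) = (2^(a+b−2) Γ(c+1/2) Γ((a+b+1)/2) Γ(c − (a+b)/2 + 1/2)) / (Γ(1/2) Γ(a) Γ(b)) · [ Γ(a/2) Γ(b/2) / (Γ(c − a/2 + 1/2) Γ(c − b/2 + 1/2)) + ((2c − d)/d) · Γ((a+1)/2) Γ((b+1)/2) / (Γ(c − a/2 + 1) Γ(c − b/2 + 1)) ]. -/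

import Mathlib

open scoped Nat

/-- Pochhammer symbol `(x)_k = x (x+1) ⋯ (x+k-1)` for a complex number `x`. -/
noncomputable def poch (x : ℂ) (k : ℕ) : ℂ := (ascPochhammer ℂ k).eval x

/-- The generalized hypergeometric series
`ₚF_q(a₁,…,aₚ; b₁,…,b_q; z) = ∑ₖ ((a₁)ₖ ⋯ (aₚ)ₖ)/((b₁)ₖ ⋯ (b_q)ₖ) · zᵏ/k!`. -/
noncomputable def hyp (a b : List ℂ) (z : ℂ) : ℂ :=
  ∑' k : ℕ, ((a.map (poch · k)).prod / (b.map (poch · k)).prod) * z ^ k / (k ! : ℂ)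

section

open Complex Filter Topology Asymptotics

lemma poch_zero (x : ℂ) : poch x 0 = 1 := by simp [poch]

lemma poch_succ (x : ℂ) (k : ℕ) : poch x (k + 1) = poch x k * (x + k) := by
  simp [poch, ascPochhammer_succ_eval]

lemma poch_succ_left (x : ℂ) (k : ℕ) : poch x (k + 1) = x * poch (x + 1) k := by
  induction k with
  | zero => simp [poch_succ, poch_zero]
  | succ k ih => rw [poch_succ, ih, poch_succ (x + 1)]; push_cast; ring

lemma poch_one (k : ℕ) : poch 1 k = (k ! : ℂ) := by
  simp [poch, ascPochhammer_eval_one]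

lemma poch_eq_prod (x : ℂ) (k : ℕ) : poch x k = ∏ j ∈ Finset.range k, (x + j) := by
  induction k with
  | zero => simp [poch_zero]
  | succ k ih => rw [poch_succ, ih, Finset.prod_range_succ]

lemma add_natCast_ne_zero {x : ℂ} (hx : ∀ n : ℕ, x ≠ -(n : ℂ)) (n : ℕ) : x + n ≠ 0 :=
  fun h => hx n (eq_neg_of_add_eq_zero_left h)

lemma poch_ne_zero {x : ℂ} (hx : ∀ n : ℕ, x ≠ -(n : ℂ)) (k : ℕ) : poch x k ≠ 0 := by
  rw [poch_eq_prod]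
  exact Finset.prod_ne_zero_iff.2 fun j _ => add_natCast_ne_zero hx j

/-- Euler's limit formula for `1 / Γ`, valid at every complex number. -/
lemma tendsto_poch_div (s : ℂ) :
    Tendsto (fun n : ℕ => poch s (n + 1) / ((n : ℂ) ^ s * n !)) atTop (𝓝 (Gamma s)⁻¹) := by
  have hG : ∀ n : ℕ, poch s (n + 1) / ((n : ℂ) ^ s * n !) = (GammaSeq s n)⁻¹ := by
    intro n
    rw [GammaSeq, inv_div, poch_eq_prod]
  simp_rw [hG]
  by_cases h : Gamma s = 0
  · obtain ⟨m, hm⟩ := (Gamma_eq_zero_iff s).1 h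
    rw [h, inv_zero]
    refine tendsto_const_nhds.congr' ?_
    filter_upwards [eventually_ge_atTop m] with n hn
    rw [← hG, poch_eq_prod, Finset.prod_eq_zero (i := m) (by simp; omega) (by simp [hm]), zero_div]
  · exact (GammaSeq_tendsto_Gamma s).inv₀ h

lemma norm_natCast_cpow_mul_factorial (s : ℂ) {n : ℕ} (hn : 0 < n) :
    ‖(n : ℂ) ^ s * (n ! : ℂ)‖ = (n : ℝ) ^ s.re * (n ! : ℝ) := by
  rw [norm_mul, norm_natCast_cpow_of_pos hn, norm_natCast]

lemma rpow_mul_factorial_ne_zero (x : ℝ) {n : ℕ} (hn : 0 < n) :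
    (n : ℝ) ^ x * (n ! : ℝ) ≠ 0 := by positivity

lemma isBigO_poch (s : ℂ) :
    (fun n : ℕ => poch s (n + 1)) =O[atTop] fun n : ℕ => (n : ℝ) ^ s.re * (n ! : ℝ) := by
  have h := ((tendsto_poch_div s).isBigO_one ℝ).norm_left.mul
    (isBigO_refl (fun n : ℕ => (n : ℝ) ^ s.re * (n ! : ℝ)) atTop)
  refine IsBigO.of_norm_left (h.congr' ?_ (by simp))
  filter_upwards [eventually_gt_atTop 0] with n hn
  rw [norm_div, norm_natCast_cpow_mul_factorial s hn,
    div_mul_cancel₀ _ (rpow_mul_factorial_ne_zero _ hn)]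

lemma isBigO_inv_poch {s : ℂ} (hs : ∀ n : ℕ, s ≠ -(n : ℂ)) :
    (fun n : ℕ => (poch s (n + 1))⁻¹) =O[atTop]
      fun n : ℕ => ((n : ℝ) ^ s.re * (n ! : ℝ))⁻¹ := by
  have h := (((tendsto_poch_div s).inv₀ (inv_ne_zero (Gamma_ne_zero hs))).isBigO_one
    ℝ).norm_left.mul (isBigO_refl (fun n : ℕ => ((n : ℝ) ^ s.re * (n ! : ℝ))⁻¹) atTop)
  refine IsBigO.of_norm_left (h.congr' ?_ (by simp))
  filter_upwards [eventually_gt_atTop 0] with n hn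
  rw [inv_div, norm_div, norm_natCast_cpow_mul_factorial s hn, norm_inv, div_eq_mul_inv,
    mul_right_comm, mul_inv_cancel₀ (rpow_mul_factorial_ne_zero _ hn), one_mul]

/-- If `f` satisfies a first-order recurrence with linear factors of equal total degree and
parameter sum, and tends to `L`, then `f 0` is `L` times a quotient of Gamma values. -/
lemma eq_of_recurrence_of_tendsto {f : ℕ → ℂ} {p q r s L : ℂ}
    (hf : ∀ n : ℕ, f n * ((p + n) * (q + n)) = f (n + 1) * ((r + n) * (s + n)))
    (hpq : p + q = r + s) (hL : Tendsto f atTop (𝓝 L)) :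
    f 0 * ((Gamma p)⁻¹ * (Gamma q)⁻¹) = L * ((Gamma r)⁻¹ * (Gamma s)⁻¹) := by
  have hprod : ∀ n, f 0 * (poch p n * poch q n) = f n * (poch r n * poch s n) := by
    intro n
    induction n with
    | zero => simp [poch_zero]
    | succ n ih =>
      simp only [poch_succ]
      linear_combination ((p + n) * (q + n)) * ih + (poch r n * poch s n) * hf n
  have h1 := ((tendsto_poch_div p).mul (tendsto_poch_div q)).const_mul (f 0)
  have h2 := (hL.comp (tendsto_add_atTop_nat 1)).mul
    ((tendsto_poch_div r).mul (tendsto_poch_div s))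
  refine tendsto_nhds_unique (h1.congr' ?_) h2
  filter_upwards [eventually_gt_atTop 0] with n hn
  have hn' : (n : ℂ) ≠ 0 := by exact_mod_cast hn.ne'
  have e : ∀ x y : ℂ, (n : ℂ) ^ x * n ! * ((n : ℂ) ^ y * n !) =
      (n : ℂ) ^ (x + y) * (n ! * n !) := by
    intro x y
    rw [cpow_add _ _ hn']
    ring
  simp only [Function.comp_apply, div_mul_div_comm, e, hpq]
  rw [← mul_div_assoc, ← mul_div_assoc, hprod]

/-- The terms of the hypergeometric series `₃F₂(a, b, c; e, f; 1)`. -/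
noncomputable def term32 (a b c e f : ℂ) (k : ℕ) : ℂ :=
  poch a k * poch b k * poch c k / (poch e k * poch f k * k !)

lemma term32_succ (a b c e f : ℂ) (k : ℕ) :
    term32 a b c e f (k + 1) =
      term32 a b c e f k * ((a + k) * (b + k) * (c + k) / ((e + k) * (f + k) * (k + 1))) := by
  simp only [term32, poch_succ, Nat.factorial_succ]
  push_cast
  rw [div_mul_div_comm]
  congr 1 <;> ring

lemma one_ne_neg_natCast (n : ℕ) : (1 : ℂ) ≠ -(n : ℂ) := fun h => by
  have := congrArg re h
  simp at this
  linarith [n.cast_nonneg (α := ℝ)]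

lemma isBigO_term32 (a b c : ℂ) {e f : ℂ} (he : ∀ n : ℕ, e ≠ -(n : ℂ))
    (hf : ∀ n : ℕ, f ≠ -(n : ℂ)) :
    (fun n : ℕ => term32 a b c e f (n + 1)) =O[atTop]
      fun n : ℕ => (n : ℝ) ^ ((a + b + c - e - f).re - 1) := by
  have h := (((isBigO_poch a).mul (isBigO_poch b)).mul (isBigO_poch c)).mul
    (((isBigO_inv_poch he).mul (isBigO_inv_poch hf)).mul (isBigO_inv_poch one_ne_neg_natCast))
  refine h.congr' ?_ ?_
  · refine Eventually.of_forall fun n => ?_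
    simp only [term32, poch_one, div_eq_mul_inv, mul_inv]
  · filter_upwards [eventually_gt_atTop 0] with n hn
    have hn' : (0 : ℝ) < n := by exact_mod_cast hn
    have hfac : (n ! : ℝ) ≠ 0 := by exact_mod_cast n.factorial_ne_zero
    simp only [sub_re, add_re, one_re, Real.rpow_sub hn', Real.rpow_add hn', Real.rpow_one]
    have := (Real.rpow_pos_of_pos hn' e.re).ne'
    have := (Real.rpow_pos_of_pos hn' f.re).ne'
    field_simp

lemma summable_norm_term32 {a b c e f : ℂ} (he : ∀ n : ℕ, e ≠ -(n : ℂ))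
    (hf : ∀ n : ℕ, f ≠ -(n : ℂ)) (h : 0 < (e + f - a - b - c).re) :
    Summable fun n => ‖term32 a b c e f n‖ := by
  rw [← summable_nat_add_iff 1]
  refine summable_of_isBigO_nat ?_ (isBigO_term32 a b c he hf).norm_left
  rw [Real.summable_nat_rpow]
  simp only [sub_re, add_re] at h ⊢
  linarith

lemma summable_term32 {a b c e f : ℂ} (he : ∀ n : ℕ, e ≠ -(n : ℂ))
    (hf : ∀ n : ℕ, f ≠ -(n : ℂ)) (h : 0 < (e + f - a - b - c).re) :
    Summable (term32 a b c e f) :=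
  (summable_norm_term32 he hf h).of_norm

lemma tendsto_mul_term32 {a b c e f : ℂ} (he : ∀ n : ℕ, e ≠ -(n : ℂ))
    (hf : ∀ n : ℕ, f ≠ -(n : ℂ)) (h : 0 < (e + f - a - b - c).re) :
    Tendsto (fun n : ℕ => (n : ℂ) * term32 a b c e f (n + 1)) atTop (𝓝 0) := by
  have h1 : (fun n : ℕ => (n : ℂ)) =O[atTop] fun n : ℕ => (n : ℝ) :=
    IsBigO.of_norm_norm (by simpa using isBigO_refl _ _)
  refine (h1.mul (isBigO_term32 a b c he hf)).trans_tendsto ?_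
  have h2 := (tendsto_rpow_neg_atTop h).comp tendsto_natCast_atTop_atTop
  refine h2.congr' ?_
  filter_upwards [eventually_gt_atTop 0] with n hn
  have hn' : (0 : ℝ) < n := by exact_mod_cast hn
  rw [Real.rpow_sub hn', Real.rpow_one, mul_div_cancel₀ _ hn'.ne', Function.comp_apply]
  congr 1
  simp only [sub_re, add_re]
  ring

lemma summable_norm_term32_mul_geometric (a b c : ℂ) {e f : ℂ} (he : ∀ n : ℕ, e ≠ -(n : ℂ))
    (hf : ∀ n : ℕ, f ≠ -(n : ℂ)) :
    Summable fun n => ‖term32 a b c e f n * (1 / 2) ^ n‖ := by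
  rw [← summable_nat_add_iff 1]
  obtain ⟨m, hm⟩ := exists_nat_ge ((a + b + c - e - f).re - 1)
  have hg : Summable fun n : ℕ => (n : ℝ) ^ m * (1 / 2 : ℝ) ^ n :=
    summable_pow_mul_geometric_of_norm_lt_one m (by norm_num)
  have h1 : (fun n : ℕ => (n : ℝ) ^ ((a + b + c - e - f).re - 1)) =O[atTop]
      fun n : ℕ => (n : ℝ) ^ m := by
    refine IsBigO.of_bound 1 ?_
    filter_upwards [eventually_gt_atTop 0] with n hn
    have hn' : (1 : ℝ) ≤ n := by exact_mod_cast hn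
    rw [one_mul, ← Real.rpow_natCast]
    exact abs_le_abs_of_nonneg (by positivity) (Real.rpow_le_rpow_of_exponent_le hn' hm)
  have h2 : (fun n : ℕ => (1 / 2 : ℂ) ^ (n + 1)) =O[atTop] fun n : ℕ => (1 / 2 : ℝ) ^ n := by
    refine IsBigO.of_bound 1 (Eventually.of_forall fun n => ?_)
    simp [pow_succ]
    norm_num
  exact summable_of_isBigO_nat hg (((isBigO_term32 a b c he hf).trans h1).mul h2).norm_left

lemma tsum_add_one_sub_of_tendsto {G : ℕ → ℂ} (h0 : G 0 = 0) (hG : Tendsto G atTop (𝓝 0))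
    (hs : Summable fun n => G (n + 1) - G n) : ∑' n, (G (n + 1) - G n) = 0 := by
  have h := hs.hasSum.tendsto_sum_nat
  simp only [Finset.sum_range_sub, h0, sub_zero] at h
  exact tendsto_nhds_unique h hG

/-- The terms of the hypergeometric series `₂F₁(a, b; e; 1)`. -/
noncomputable def term21 (a b e : ℂ) (k : ℕ) : ℂ := poch a k * poch b k / (poch e k * k !)

lemma term21_eq (a b e : ℂ) : term21 a b e = term32 a b 1 e 1 := by
  funext k
  have := poch_ne_zero one_ne_neg_natCast k
  rw [term21, term32, mul_right_comm (poch e k), mul_div_mul_right _ _ this]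

lemma term21_zero (a b e : ℂ) : term21 a b e 0 = 1 := by simp [term21, poch_zero]

lemma term21_succ (a b e : ℂ) (k : ℕ) :
    term21 a b e (k + 1) = term21 a b e k * ((a + k) * (b + k) / ((e + k) * (k + 1))) := by
  simp only [term21, poch_succ, Nat.factorial_succ]
  push_cast
  rw [div_mul_div_comm]
  congr 1 <;> ring

lemma summable_norm_term21_mul_geometric (a b : ℂ) {e : ℂ} (he : ∀ n : ℕ, e ≠ -(n : ℂ)) :
    Summable fun n => ‖term21 a b e n * (1 / 2) ^ n‖ := by
  rw [term21_eq]
  exact summable_norm_term32_mul_geometric a b 1 he one_ne_neg_natCast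

lemma poch_add_two (e : ℂ) (k : ℕ) :
    e * (e + 1) * poch (e + 2) k = poch e k * ((e + k) * (e + k + 1)) := by
  have h1 := poch_succ_left e (k + 1)
  rw [poch_succ_left (e + 1), poch_succ, poch_succ, add_assoc e 1 1, one_add_one_eq_two] at h1
  push_cast at h1
  linear_combination -h1

lemma add_ne_neg_natCast {x : ℂ} (hx : ∀ n : ℕ, x ≠ -(n : ℂ)) (m n : ℕ) :
    x + m ≠ -(n : ℂ) := fun h => hx (n + m) (by push_cast; linear_combination h)

lemma tsum_term21_recurrence (A : ℂ) {e : ℂ} (he : ∀ n : ℕ, e ≠ -(n : ℂ)) :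
    (e * (e + 1)) * ∑' k, term21 A (1 - A) e k * (1 / 2) ^ k =
      ((e + A) * (e + 1 - A)) * ∑' k, term21 A (1 - A) (e + 2) k * (1 / 2) ^ k := by
  have he2 : ∀ n : ℕ, e + 2 ≠ -(n : ℂ) := by exact_mod_cast add_ne_neg_natCast he 2
  have hs := (summable_norm_term21_mul_geometric A (1 - A) he).of_norm
  have hs2 := (summable_norm_term21_mul_geometric A (1 - A) he2).of_norm
  set G : ℕ → ℂ := fun k => 2 * k * (e * (e + 1) / (e + k) * (term21 A (1 - A) e k * (1 / 2) ^ k))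
    with hG
  have hstep : ∀ k : ℕ, (e + A) * (e + 1 - A) * (term21 A (1 - A) (e + 2) k * (1 / 2) ^ k) -
      e * (e + 1) * (term21 A (1 - A) e k * (1 / 2) ^ k) = G (k + 1) - G k := by
    intro k
    have e0 := add_natCast_ne_zero he 0
    have e1 := add_natCast_ne_zero he 1
    have ek := add_natCast_ne_zero he k
    have ek1 := add_natCast_ne_zero he (k + 1)
    have hk : (k : ℂ) + 1 ≠ 0 := by exact_mod_cast k.succ_ne_zero
    push_cast at e0 e1 ek1
    rw [add_zero] at e0
    rw [← add_assoc] at ek1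
    have h2 : term21 A (1 - A) (e + 2) k =
        term21 A (1 - A) e k * (e * (e + 1) / ((e + k) * (e + k + 1))) := by
      have hp : poch (e + 2) k = poch e k * ((e + k) * (e + k + 1)) / (e * (e + 1)) := by
        rw [← poch_add_two]
        field_simp
      have := poch_ne_zero he k
      have : (k ! : ℂ) ≠ 0 := by exact_mod_cast k.factorial_ne_zero
      rw [term21, term21, hp]
      field_simp
    simp only [hG]
    rw [h2, term21_succ, pow_succ]
    push_cast
    rw [← add_assoc]
    field_simp
    ring
  have hG0 : Tendsto G atTop (𝓝 0) := by
    have h := ((tendsto_natCast_div_add_atTop e).mul hs.tendsto_atTop_zero).const_mul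
      (2 * (e * (e + 1)))
    rw [mul_zero, mul_zero] at h
    refine h.congr fun k => ?_
    simp only [hG, add_comm (k : ℂ) e]
    ring
  have hsum : Summable fun k => G (k + 1) - G k := by
    simp only [← hstep]
    exact (hs2.mul_left _).sub (hs.mul_left _)
  have h := tsum_add_one_sub_of_tendsto (by simp [hG]) hG0 hsum
  simp only [← hstep] at h
  rw [(hs2.mul_left _).tsum_sub (hs.mul_left _), tsum_mul_left, tsum_mul_left] at h
  linear_combination -h

lemma sum_antidiagonal_term21 (α β : ℂ) {e : ℂ} (he : ∀ n : ℕ, e ≠ -(n : ℂ)) (k : ℕ) :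
    ∑ i ∈ Finset.range (k + 1), term21 α β e i * (poch (e - α - β) (k - i) / ((k - i)! : ℕ)) =
      term21 (e - α) (e - β) e k := by
  set v : ℕ → ℂ := fun j => poch (e - α - β) j / (j ! : ℕ) with hv
  change ∑ i ∈ Finset.range (k + 1), term21 α β e i * v (k - i) = _
  have hv0 : v 0 = 1 := by simp [hv, poch_zero]
  have hv1 : ∀ j : ℕ, v (j + 1) * (j + 1) = v j * (e - α - β + j) := by
    intro j
    have : (j ! : ℂ) ≠ 0 := by exact_mod_cast j.factorial_ne_zero
    have : (j : ℂ) + 1 ≠ 0 := by exact_mod_cast j.succ_ne_zero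
    simp only [hv, poch_succ, Nat.factorial_succ]
    push_cast
    field_simp
  have hu1 : ∀ i : ℕ, term21 α β e (i + 1) * ((e + i) * (i + 1)) =
      term21 α β e i * ((α + i) * (β + i)) := by
    intro i
    have := add_natCast_ne_zero he i
    have : (i : ℂ) + 1 ≠ 0 := by exact_mod_cast i.succ_ne_zero
    rw [term21_succ]
    field_simp
  have hu0 := term21_zero α β e
  generalize term21 α β e = u at hu0 hu1 ⊢
  induction k with
  | zero => simp [hu0, hv0, term21_zero]
  | succ k ih =>
    set G : ℕ → ℂ := fun i => -(i * (e + i - 1) * u i * v (k + 1 - i)) with hG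
    have hstep : ∀ i ∈ Finset.range (k + 1), (e + k) * (k + 1) * (u i * v (k + 1 - i)) -
        (e - α + k) * (e - β + k) * (u i * v (k - i)) = G (i + 1) - G i := by
      intro i hi
      obtain ⟨j, rfl⟩ : ∃ j, k = i + j := ⟨k - i, by grind⟩
      have e1 : i + j + 1 - i = j + 1 := by omega
      have e2 : i + j + 1 - (i + 1) = j := by omega
      have e3 : i + j - i = j := by omega
      simp only [hG, e1, e2, e3]
      push_cast
      linear_combination (e + 2 * i + j) * u i * hv1 j + v j * hu1 i
    have hsum := Finset.sum_congr rfl hstep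
    rw [Finset.sum_range_sub, Finset.sum_sub_distrib, ← Finset.mul_sum, ← Finset.mul_sum,
      ih] at hsum
    have ek := add_natCast_ne_zero he k
    have hk : (k : ℂ) + 1 ≠ 0 := by exact_mod_cast k.succ_ne_zero
    rw [Finset.sum_range_succ, term21_succ, Nat.sub_self, hv0]
    simp only [hG, Nat.sub_self, hv0] at hsum
    push_cast at hsum
    rw [mul_div_assoc', eq_div_iff (mul_ne_zero ek hk)]
    linear_combination hsum

lemma tendsto_inv_add_two_mul (z : ℂ) :
    Tendsto (fun n : ℕ => (z + 2 * n)⁻¹) atTop (𝓝 0) := by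
  have h := (tendsto_natCast_div_add_atTop z).mul (tendsto_inv_atTop_nhds_zero_nat (𝕜 := ℂ))
  rw [mul_zero] at h
  refine (h.comp (tendsto_id.const_mul_atTop' (Nat.succ_pos 1))).congr' ?_
  filter_upwards [eventually_gt_atTop 0] with n hn
  have hn' : (n : ℂ) ≠ 0 := by exact_mod_cast hn.ne'
  simp only [Function.comp_apply, id]
  push_cast
  field_simp
  norm_num [add_comm]

lemma tendsto_inv_poch_add (e : ℂ) (k : ℕ) :
    Tendsto (fun n : ℕ => (poch (e + 2 * n) (k + 1))⁻¹) atTop (𝓝 0) := by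
  induction k with
  | zero => simpa [poch_succ, poch_zero] using tendsto_inv_add_two_mul e
  | succ k ih =>
    have h := ih.mul (tendsto_inv_add_two_mul (e + (k + 1 : ℕ)))
    rw [mul_zero] at h
    refine h.congr fun n => ?_
    rw [poch_succ _ (k + 1), mul_inv]
    ring

lemma factorial_le_norm_poch {x : ℂ} (hx : 1 ≤ x.re) (k : ℕ) : (k ! : ℝ) ≤ ‖poch x k‖ := by
  induction k with
  | zero => simp [poch_zero]
  | succ k ih =>
    rw [poch_succ, norm_mul, Nat.factorial_succ, mul_comm]
    push_cast
    refine mul_le_mul ih ?_ (by positivity) (norm_nonneg _)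
    refine le_trans ?_ (re_le_norm _)
    simp
    linarith

lemma tendsto_tsum_term21 (A B e : ℂ) :
    Tendsto (fun n : ℕ => ∑' k, term21 A B (e + 2 * n) k * (1 / 2) ^ k) atTop (𝓝 1) := by
  have h : ∑' k : ℕ, (if k = 0 then (1 : ℂ) else 0) = 1 := by simp
  refine Eq.subst (motive := fun z => Tendsto _ _ (𝓝 z)) h ?_
  refine tendsto_tsum_of_dominated_convergence
    (summable_norm_term21_mul_geometric A B one_ne_neg_natCast) (fun k => ?_) ?_
  · cases k with
    | zero => simp [term21_zero]
    | succ k =>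
      have := (tendsto_inv_poch_add e k).const_mul
        (poch A (k + 1) * poch B (k + 1) * ((k + 1)! : ℂ)⁻¹ * (1 / 2) ^ (k + 1))
      rw [mul_zero] at this
      simp only [Nat.add_eq_zero_iff, one_ne_zero, and_false, if_false]
      refine this.congr fun n => ?_
      simp only [term21, div_eq_mul_inv, mul_inv]
      ring
  · obtain ⟨N, hN⟩ := exists_nat_ge (1 - e.re)
    filter_upwards [eventually_ge_atTop N] with n hn k
    have hn' : (N : ℝ) ≤ n := by exact_mod_cast hn
    have hre : 1 ≤ (e + 2 * n).re := by
      simp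
      linarith [n.cast_nonneg (α := ℝ)]
    have hf : (0 : ℝ) < k ! := by exact_mod_cast k.factorial_pos
    have hle := factorial_le_norm_poch hre k
    simp only [term21, poch_one, norm_mul, norm_div]
    rw [Complex.norm_natCast]
    gcongr

/-- Bailey's theorem on `₂F₁(A, 1 - A; e; 1/2)`. -/
lemma bailey_summation (A : ℂ) {e : ℂ} (he : ∀ n : ℕ, e ≠ -(n : ℂ)) :
    ∑' k, term21 A (1 - A) e k * (1 / 2) ^ k =
      Gamma (e / 2) * Gamma ((e + 1) / 2) / (Gamma ((e + A) / 2) * Gamma ((e + 1 - A) / 2)) := by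
  have h := eq_of_recurrence_of_tendsto
    (f := fun n : ℕ => ∑' k, term21 A (1 - A) (e + 2 * n) k * (1 / 2) ^ k)
    (p := e / 2) (q := (e + 1) / 2) (r := (e + A) / 2) (s := (e + 1 - A) / 2) (L := 1)
    (fun n => ?_) (by ring) (tendsto_tsum_term21 A (1 - A) e)
  · have h1 : Gamma (e / 2) ≠ 0 := Gamma_ne_zero fun m hm =>
      he (2 * m) (by push_cast; linear_combination 2 * hm)
    have h2 : Gamma ((e + 1) / 2) ≠ 0 := Gamma_ne_zero fun m hm =>
      he (2 * m + 1) (by push_cast; linear_combination 2 * hm)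
    simp only [Nat.cast_zero, mul_zero, add_zero, one_mul] at h
    rw [← mul_inv, ← mul_inv, ← div_eq_mul_inv, div_eq_iff (mul_ne_zero h1 h2)] at h
    rw [h, ← div_eq_inv_mul]
  · have hen : ∀ m : ℕ, e + 2 * n ≠ -(m : ℂ) := by
      exact_mod_cast add_ne_neg_natCast he (2 * n)
    have h := tsum_term21_recurrence A hen
    push_cast
    rw [show e + 2 * ((n : ℂ) + 1) = e + 2 * n + 2 by ring]
    linear_combination h / 4

lemma hasSum_poch_div_factorial (σ : ℂ) :
    HasSum (fun n : ℕ => poch σ n / (n ! : ℕ) * (1 / 2) ^ n) ((2 : ℂ) ^ σ) := by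
  have h := (one_div_one_sub_cpow_hasFPowerSeriesOnBall_zero σ).hasSum (y := 1 / 2) (by
    simp [← ofReal_norm])
  have h2 : 1 / (1 - (0 + 1 / 2 : ℂ)) ^ σ = 2 ^ σ := by
    have h3 := inv_cpow_ofReal_nonneg (a := 2) zero_le_two σ
    push_cast at h3
    rw [show (1 - (0 + 1 / 2) : ℂ) = 2⁻¹ by norm_num, h3, one_div, inv_inv]
  rw [h2] at h
  have h3 : ∀ n : ℕ, poch σ n / (n ! : ℕ) = Ring.choose (σ + n - 1) n := by
    intro n
    have h4 := Ring.factorial_nsmul_multichoose_eq_ascPochhammer σ n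
    rw [Polynomial.ascPochhammer_smeval_eq_eval, Ring.multichoose_eq, nsmul_eq_mul] at h4
    rw [poch, ← h4, mul_div_cancel_left₀ _ (by exact_mod_cast n.factorial_ne_zero)]
  simp only [FormalMultilinearSeries.ofScalars_apply_eq, smul_eq_mul, ← h3] at h
  exact h

/-- Gauss's second summation theorem. -/
lemma gauss_second_summation {a b e : ℂ} (hab : a + b + 1 = 2 * e)
    (he : ∀ n : ℕ, e ≠ -(n : ℂ)) :
    ∑' k, term21 a b e k * (1 / 2) ^ k =
      √Real.pi * Gamma e / (Gamma ((a + 1) / 2) * Gamma ((b + 1) / 2)) := by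
  obtain rfl : b = 2 * e - 1 - a := by linear_combination hab
  have hσ := hasSum_poch_div_factorial (e - (e - a) - (1 - (e - a)))
  have hσs : Summable fun n : ℕ =>
      ‖poch (e - (e - a) - (1 - (e - a))) n / (n ! : ℕ) * (1 / 2) ^ n‖ := by
    refine (summable_norm_term21_mul_geometric (e - (e - a) - (1 - (e - a))) 1
      one_ne_neg_natCast).congr fun n => ?_
    rw [term21, mul_comm, mul_comm (poch 1 n) (n ! : ℂ), mul_div_mul_right _ _
      (poch_ne_zero one_ne_neg_natCast n), mul_comm]
  have hB := summable_norm_term21_mul_geometric (e - a) (1 - (e - a)) he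
  have hprod := tsum_mul_tsum_eq_tsum_sum_range_of_summable_norm hB hσs
  rw [hσ.tsum_eq, bailey_summation _ he] at hprod
  have hcoef : ∀ k : ℕ, ∑ i ∈ Finset.range (k + 1), term21 (e - a) (1 - (e - a)) e i * (1 / 2) ^ i *
      (poch (e - (e - a) - (1 - (e - a))) (k - i) / ((k - i)! : ℕ) * (1 / 2) ^ (k - i)) =
      term21 a (2 * e - 1 - a) e k * (1 / 2) ^ k := by
    intro k
    have h := sum_antidiagonal_term21 (e - a) (1 - (e - a)) he k
    rw [show e - (1 - (e - a)) = 2 * e - 1 - a by ring, sub_sub_cancel] at h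
    rw [← h, Finset.sum_mul]
    refine Finset.sum_congr rfl fun i hi => ?_
    obtain ⟨j, rfl⟩ : ∃ j, k = i + j := ⟨k - i, by grind⟩
    rw [show i + j - i = j by omega, pow_add, sub_sub_cancel]
    ring
  simp only [hcoef] at hprod
  rw [← hprod]
  have hdup := Gamma_mul_Gamma_add_half (e / 2)
  rw [show e / 2 + 1 / 2 = (e + 1) / 2 by ring, show 2 * (e / 2) = e by ring] at hdup
  rw [hdup, show e - (e - a) - (1 - (e - a)) = -(1 - e) by ring, cpow_neg,
    show e + (e - a) = 2 * e - 1 - a + 1 by ring, show e + 1 - (e - a) = a + 1 by ring]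
  have h2 : (2 : ℂ) ^ (1 - e) ≠ 0 := by simp [cpow_eq_zero_iff]
  field_simp

lemma norm_add_div_le {x : ℝ} (hx : 0 < x) {c : ℂ} (hc : x ≤ c.re) (k : ℕ) :
    ‖(c + k) / (2 * c + k)‖ ≤ ‖((x : ℂ) + k) / (2 * x + k)‖ := by
  have hk : (0 : ℝ) ≤ k := k.cast_nonneg
  have h1 : 0 < ‖2 * c + k‖ := by
    refine lt_of_lt_of_le ?_ (re_le_norm _)
    simp
    linarith
  have h2 : 0 < ‖2 * (x : ℂ) + k‖ := by
    refine lt_of_lt_of_le ?_ (re_le_norm _)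
    simp
    linarith
  rw [norm_div, norm_div, div_le_div_iff₀ h1 h2, ← norm_mul, ← norm_mul]
  refine (sq_le_sq₀ (norm_nonneg _) (norm_nonneg _)).1 ?_
  simp only [Complex.sq_norm, normSq_apply]
  simp
  have h3 : 0 ≤ k * (c.re - x) := mul_nonneg hk (by linarith)
  have h4 : 0 ≤ (x + k) * (2 * c.re + k) + (c.re + k) * (2 * x + k) := by
    have : 0 ≤ c.re := by linarith
    positivity
  have h5 : 0 ≤ c.im ^ 2 * (k * (4 * x + 3 * k)) := by positivity
  nlinarith [mul_nonneg h3 h4]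

lemma norm_poch_div_le {x : ℝ} (hx : 0 < x) {c : ℂ} (hc : x ≤ c.re) (k : ℕ) :
    ‖poch c k / poch (2 * c) k‖ ≤ ‖poch x k / poch (2 * x) k‖ := by
  induction k with
  | zero => simp [poch_zero]
  | succ k ih =>
    simp only [poch_succ, mul_div_mul_comm, norm_mul]
    exact mul_le_mul ih (norm_add_div_le hx hc k) (norm_nonneg _) (norm_nonneg _)

lemma tendsto_poch_div_poch (c : ℂ) (k : ℕ) :
    Tendsto (fun n : ℕ => poch (c + n) k / poch (2 * (c + n)) k) atTop (𝓝 ((1 / 2) ^ k)) := by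
  induction k with
  | zero => simp [poch_zero]
  | succ k ih =>
    simp only [poch_succ, mul_div_mul_comm, pow_succ]
    refine ih.mul ?_
    have h := ((tendsto_inv_add_two_mul (2 * c + k)).const_mul ((k : ℂ) / 2)).const_add (1 / 2)
    rw [mul_zero, add_zero] at h
    refine h.congr' ?_
    obtain ⟨N, hN⟩ := exists_nat_gt (-c.re)
    filter_upwards [eventually_ge_atTop N] with n hn
    have hn' : (N : ℝ) ≤ n := by exact_mod_cast hn
    have h0 : 2 * c + k + 2 * n ≠ 0 := fun h => by
      have := congrArg re h
      simp at this
      linarith [k.cast_nonneg (α := ℝ)]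
    rw [show 2 * (c + n) + (k : ℂ) = 2 * c + k + 2 * n by ring]
    field_simp
    ring

lemma term32_eq_term21_mul (a b c e : ℂ) (k : ℕ) :
    term32 a b c e (2 * c) k = term21 a b e k * (poch c k / poch (2 * c) k) := by
  rw [term32, term21, div_mul_div_comm]
  congr 1
  ring

lemma tendsto_tsum_term32 (a b c : ℂ) {e : ℂ} (he : ∀ n : ℕ, e ≠ -(n : ℂ)) :
    Tendsto (fun n : ℕ => ∑' k, term32 a b (c + n) e (2 * (c + n)) k) atTop
      (𝓝 (∑' k, term21 a b e k * (1 / 2) ^ k)) := by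
  obtain ⟨x, hx⟩ := exists_gt (max 0 (a + b - e).re)
  have hx0 : 0 < x := (le_max_left _ _).trans_lt hx
  have hx1 : (a + b - e).re < x := (le_max_right _ _).trans_lt hx
  have h2x : ∀ n : ℕ, 2 * (x : ℂ) ≠ -(n : ℂ) := fun n h => by
    have := congrArg re h
    simp at this
    linarith [n.cast_nonneg (α := ℝ)]
  have hs : Summable fun k => ‖term32 a b x e (2 * x) k‖ := by
    refine summable_norm_term32 he h2x ?_
    simp at hx1 ⊢
    linarith
  simp only [term32_eq_term21_mul] at hs ⊢
  refine tendsto_tsum_of_dominated_convergence hs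
    (fun k => (tendsto_poch_div_poch c k).const_mul _) ?_
  obtain ⟨N, hN⟩ := exists_nat_ge (x - c.re)
  filter_upwards [eventually_ge_atTop N] with n hn k
  have hn' : (N : ℝ) ≤ n := by exact_mod_cast hn
  rw [norm_mul, norm_mul]
  refine mul_le_mul_of_nonneg_left (norm_poch_div_le hx0 ?_ k) (norm_nonneg _)
  simp
  linarith

lemma tsum_term32_recurrence {a b c e : ℂ} (hab : a + b + 1 = 2 * e)
    (he : ∀ n : ℕ, e ≠ -(n : ℂ)) (hc : ∀ n : ℕ, 2 * c ≠ -(n : ℂ))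
    (h : 0 < (c + 1 - e).re) :
    (c + 1 / 2) * (c + 1 - e) * ∑' k, term32 a b c e (2 * c) k =
      (c + (1 - a) / 2) * (c + (1 - b) / 2) *
        ∑' k, term32 a b (c + 1) e (2 * (c + 1)) k := by
  obtain rfl : b = 2 * e - 1 - a := by linear_combination hab
  have hc2 : ∀ n : ℕ, 2 * (c + 1) ≠ -(n : ℂ) := by
    intro n
    rw [mul_add, mul_one]
    exact_mod_cast add_ne_neg_natCast hc 2 n
  have hre : 0 < (e + 2 * c - a - (2 * e - 1 - a) - c).re := by
    rwa [show e + 2 * c - a - (2 * e - 1 - a) - c = c + 1 - e by ring]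
  have hre2 : 0 < (e + 2 * (c + 1) - a - (2 * e - 1 - a) - (c + 1)).re := by
    rw [show e + 2 * (c + 1) - a - (2 * e - 1 - a) - (c + 1) = c + 1 - e + 1 by ring, add_re,
      one_re]
    linarith
  have hs := summable_term32 he hc hre
  have hs2 := summable_term32 he hc2 hre2
  have ht := tendsto_mul_term32 he hc hre
  set t := term32 a (2 * e - 1 - a) c e (2 * c) with htdef
  set G : ℕ → ℂ := fun k => (c + 1 / 2) * (k / (2 * c + k) * ((e + k - 1) * t k)) with hG
  have hstep : ∀ k : ℕ, (c + (1 - a) / 2) * (c + (1 - (2 * e - 1 - a)) / 2) *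
      term32 a (2 * e - 1 - a) (c + 1) e (2 * (c + 1)) k - (c + 1 / 2) * (c + 1 - e) * t k =
        G (k + 1) - G k := by
    intro k
    have c0 := add_natCast_ne_zero hc 0
    have c1 := add_natCast_ne_zero hc 1
    have ck := add_natCast_ne_zero hc k
    have ck1 := add_natCast_ne_zero hc (k + 1)
    have ek := add_natCast_ne_zero he k
    have hk : (k : ℂ) + 1 ≠ 0 := by exact_mod_cast k.succ_ne_zero
    push_cast at c0 c1 ck1
    rw [add_zero] at c0
    rw [← add_assoc] at ck1
    have c00 : c ≠ 0 := right_ne_zero_of_mul c0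
    have h2 : term32 a (2 * e - 1 - a) (c + 1) e (2 * (c + 1)) k =
        t k * (2 * (2 * c + 1) * (c + k) / ((2 * c + k) * (2 * c + k + 1))) := by
      have hp : poch (2 * (c + 1)) k =
          poch (2 * c) k * ((2 * c + k) * (2 * c + k + 1)) / (2 * c * (2 * c + 1)) := by
        rw [← poch_add_two, mul_div_cancel_left₀ _ (mul_ne_zero c0 c1), mul_add, mul_one]
      have hp2 : poch (c + 1) k = poch c k * (c + k) / c := by
        rw [← poch_succ, poch_succ_left, mul_div_cancel_left₀ _ c00]
      have := poch_ne_zero he k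
      have := poch_ne_zero hc k
      have : (k ! : ℂ) ≠ 0 := by exact_mod_cast k.factorial_ne_zero
      rw [htdef, term32, term32, hp, hp2]
      field_simp
    simp only [hG]
    rw [h2, htdef, term32_succ]
    push_cast
    rw [← htdef]
    generalize t k = T
    generalize (k : ℂ) = K at *
    obtain ⟨X, hX⟩ : ∃ X, X = 2 * c + K := ⟨_, rfl⟩
    rw [← add_assoc, ← hX]
    rw [← hX] at ck ck1
    obtain rfl : c = (X - K) / 2 := by linear_combination -hX / 2
    field_simp
    ring
  have hG0 : Tendsto G atTop (𝓝 0) := by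
    rw [← tendsto_add_atTop_iff_nat 1]
    have h1 := ((hs.tendsto_atTop_zero.comp (tendsto_add_atTop_nat 1)).const_mul e).add ht
    have h2 := ((((tendsto_natCast_div_add_atTop (2 * c)).comp
      (tendsto_add_atTop_nat 1)).mul h1)).const_mul (c + 1 / 2)
    rw [mul_zero, add_zero, mul_zero, mul_zero] at h2
    refine h2.congr fun k => ?_
    simp only [hG, Function.comp_apply]
    rw [add_comm (2 * c)]
    push_cast
    ring
  have hsum : Summable fun k => G (k + 1) - G k := by
    simp only [← hstep]
    exact (hs2.mul_left _).sub (hs.mul_left _)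
  have h := tsum_add_one_sub_of_tendsto (by simp [hG]) hG0 hsum
  simp only [← hstep] at h
  rw [(hs2.mul_left _).tsum_sub (hs.mul_left _), tsum_mul_left, tsum_mul_left] at h
  linear_combination -h

/-- Watson's summation theorem. -/
lemma watson_summation {a b c e : ℂ} (hab : a + b + 1 = 2 * e)
    (he : ∀ n : ℕ, e ≠ -(n : ℂ)) (hc : ∀ n : ℕ, 2 * c ≠ -(n : ℂ))
    (h : 0 < (c + 1 - e).re) :
    ∑' k, term32 a b c e (2 * c) k =
      √Real.pi * Gamma (c + 1 / 2) * Gamma e * Gamma (c + 1 - e) /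
        (Gamma ((a + 1) / 2) * Gamma ((b + 1) / 2) *
          (Gamma (c - a / 2 + 1 / 2) * Gamma (c - b / 2 + 1 / 2))) := by
  have hlim := tendsto_tsum_term32 a b c he
  rw [gauss_second_summation hab he] at hlim
  have h0 := eq_of_recurrence_of_tendsto
    (f := fun n : ℕ => ∑' k, term32 a b (c + n) e (2 * (c + n)) k)
    (p := c + 1 / 2) (q := c + 1 - e) (r := c - a / 2 + 1 / 2) (s := c - b / 2 + 1 / 2)
    (fun n => ?_) (by linear_combination hab / 2) hlim
  · have h1 : Gamma (c + 1 / 2) ≠ 0 := Gamma_ne_zero fun m hm =>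
      hc (2 * m + 1) (by push_cast; linear_combination 2 * hm)
    have h2 : Gamma (c + 1 - e) ≠ 0 := Gamma_ne_zero_of_re_pos h
    simp only [Nat.cast_zero, add_zero] at h0
    rw [← mul_inv, ← mul_inv, ← div_eq_mul_inv, div_eq_iff (mul_ne_zero h1 h2)] at h0
    rw [h0]
    simp only [div_eq_mul_inv, mul_inv]
    ring1
  · have hcn : ∀ m : ℕ, 2 * (c + n) ≠ -(m : ℂ) := by
      intro m
      rw [mul_add]
      exact_mod_cast add_ne_neg_natCast hc (2 * n) m
    have hre : 0 < (c + n + 1 - e).re := by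
      simp at h ⊢
      linarith [n.cast_nonneg (α := ℝ)]
    have h3 := tsum_term32_recurrence hab he hcn hre
    push_cast
    rw [← add_assoc]
    linear_combination h3

lemma Gamma_one_half_eq_sqrt : Gamma (1 / 2) = √Real.pi := by
  rw [Complex.Gamma_one_half_eq, Real.sqrt_eq_rpow, ofReal_cpow Real.pi_pos.le]
  norm_num

lemma hasSum_natCast_mul_term32 {a b c e : ℂ} (hab : a + b + 1 = 2 * e)
    (he : ∀ n : ℕ, e ≠ -(n : ℂ)) (hc : ∀ n : ℕ, 2 * c + 1 ≠ -(n : ℂ))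
    (h : 0 < (c + 1 - e).re) (ha : a ≠ 0) (hb : b ≠ 0) :
    HasSum (fun k : ℕ => k * term32 a b c e (2 * c + 1) k)
      (2 * c * (√Real.pi * Gamma (c + 1 / 2) * Gamma e * Gamma (c + 1 - e) /
        (Gamma (a / 2) * Gamma (b / 2) *
          (Gamma (c - a / 2 + 1) * Gamma (c - b / 2 + 1))))) := by
  have hab' : a + 1 + (b + 1) + 1 = 2 * (e + 1) := by linear_combination hab
  have he1 : ∀ n : ℕ, e + 1 ≠ -(n : ℂ) := by exact_mod_cast add_ne_neg_natCast he 1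
  have hc1 : ∀ n : ℕ, 2 * (c + 1) ≠ -(n : ℂ) := fun n => by
    rw [show 2 * (c + 1) = 2 * c + 1 + (1 : ℕ) by push_cast; ring]
    exact add_ne_neg_natCast hc 1 n
  have h' : 0 < (c + 1 + 1 - (e + 1)).re := by rwa [add_sub_add_right_eq_sub]
  have e0 : e ≠ 0 := by simpa using he 0
  have c0 : 2 * c + 1 ≠ 0 := by simpa using hc 0
  have c2 : c + 1 / 2 ≠ 0 := fun h0 => c0 (by linear_combination 2 * h0)
  have hs : Summable (term32 (a + 1) (b + 1) (c + 1) (e + 1) (2 * (c + 1))) := by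
    refine summable_term32 he1 hc1 ?_
    rwa [show e + 1 + 2 * (c + 1) - (a + 1) - (b + 1) - (c + 1) = c + 1 - e by
      linear_combination -hab]
  have hsum := (hs.hasSum.mul_left (a * b * c / (e * (2 * c + 1))))
  rw [watson_summation hab' he1 hc1 h', Gamma_add_one e e0,
    show c + 1 + 1 / 2 = c + 1 / 2 + 1 by ring, Gamma_add_one _ c2, add_sub_add_right_eq_sub,
    show (a + 1 + 1) / 2 = a / 2 + 1 by ring, show (b + 1 + 1) / 2 = b / 2 + 1 by ring,
    Gamma_add_one (a / 2) (by simpa using ha), Gamma_add_one (b / 2) (by simpa using hb),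
    show c + 1 - (a + 1) / 2 + 1 / 2 = c - a / 2 + 1 by ring,
    show c + 1 - (b + 1) / 2 + 1 / 2 = c - b / 2 + 1 by ring] at hsum
  rw [← hasSum_nat_add_iff' 1]
  simp only [Finset.sum_range_one, Nat.cast_zero, zero_mul, sub_zero]
  have hterm : ∀ k : ℕ, ((k + 1 : ℕ) : ℂ) * term32 a b c e (2 * c + 1) (k + 1) =
      a * b * c / (e * (2 * c + 1)) *
        term32 (a + 1) (b + 1) (c + 1) (e + 1) (2 * (c + 1)) k := by
    intro k
    have := poch_ne_zero he1 k
    have := poch_ne_zero hc1 k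
    have : (k ! : ℂ) ≠ 0 := by exact_mod_cast k.factorial_ne_zero
    have : (k : ℂ) + 1 ≠ 0 := by exact_mod_cast k.succ_ne_zero
    rw [term32, term32, poch_succ_left, poch_succ_left, poch_succ_left, poch_succ_left,
      poch_succ_left, Nat.factorial_succ, show 2 * c + 1 + 1 = 2 * (c + 1) by ring]
    push_cast
    field_simp
  simp only [hterm]
  refine (congrArg (fun x => HasSum _ x) ?_).mpr hsum
  rw [show c + 1 / 2 = (2 * c + 1) / 2 by ring]
  field_simp

lemma tsum_term32_two_mul_add_one {a b c e : ℂ} (hab : a + b + 1 = 2 * e)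
    (he : ∀ n : ℕ, e ≠ -(n : ℂ)) (hc : ∀ n : ℕ, 2 * c + 1 ≠ -(n : ℂ))
    (h : 0 < (c + 1 - e).re) (ha : a ≠ 0) (hb : b ≠ 0) :
    ∑' k, term32 a b c e (2 * c + 1) k =
      √Real.pi * Gamma (c + 1 / 2) * Gamma e * Gamma (c + 1 - e) /
          (Gamma ((a + 1) / 2) * Gamma ((b + 1) / 2) *
            (Gamma (c - a / 2 + 1 / 2) * Gamma (c - b / 2 + 1 / 2))) -
        √Real.pi * Gamma (c + 1 / 2) * Gamma e * Gamma (c + 1 - e) /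
          (Gamma (a / 2) * Gamma (b / 2) * (Gamma (c - a / 2 + 1) * Gamma (c - b / 2 + 1))) := by
  rcases eq_or_ne c 0 with rfl | c0
  · have hl : ∑' k, term32 a b 0 e (2 * 0 + 1) k = 1 := by
      rw [tsum_eq_single 0]
      · simp [term32, poch_zero]
      · intro k hk
        obtain ⟨k, rfl⟩ := Nat.exists_eq_succ_of_ne_zero hk
        simp [term32, poch_succ_left 0]
    have hπ : (Real.pi : ℂ) ≠ 0 := by exact_mod_cast Real.pi_ne_zero
    have hsq : (√Real.pi : ℂ) * Gamma (1 / 2) = Real.pi := by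
      rw [Gamma_one_half_eq_sqrt, ← ofReal_mul, Real.mul_self_sqrt Real.pi_pos.le]
    rw [zero_add] at h
    have hG := Gamma_mul_Gamma_one_sub e
    have hs : sin (Real.pi * e) ≠ 0 := by
      intro hs
      rw [hs, div_zero] at hG
      exact mul_ne_zero (Gamma_ne_zero he) (Gamma_ne_zero_of_re_pos h) hG
    have key : ∀ x : ℂ, (Gamma x)⁻¹ * (Gamma (1 - x))⁻¹ = sin (Real.pi * x) / Real.pi := fun x => by
      rw [← mul_inv, Gamma_mul_Gamma_one_sub, inv_div]
    have ka := key (a / 2)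
    have kb := key (b / 2)
    have ka' := key ((a + 1) / 2)
    have kb' := key ((b + 1) / 2)
    have hsin : sin (Real.pi * e) =
        sin (Real.pi * ((a + 1) / 2)) * sin (Real.pi * ((b + 1) / 2)) -
          sin (Real.pi * (a / 2)) * sin (Real.pi * (b / 2)) := by
      rw [show Real.pi * ((a + 1) / 2) = Real.pi * (a / 2) + Real.pi / 2 by ring,
        show Real.pi * ((b + 1) / 2) = Real.pi * (b / 2) + Real.pi / 2 by ring,
        sin_add_pi_div_two, sin_add_pi_div_two, ← cos_add, ← sin_add_pi_div_two]
      congr 1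
      linear_combination -(Real.pi / 2 : ℂ) * hab
    rw [hl]
    simp only [zero_add, zero_sub]
    rw [hsq, mul_assoc, hG, show -(a / 2) + 1 / 2 = 1 - (a + 1) / 2 by ring,
      show -(b / 2) + 1 / 2 = 1 - (b + 1) / 2 by ring, neg_add_eq_sub, neg_add_eq_sub]
    rw [div_eq_mul_inv _ (_ * _ * (_ * _)), div_eq_mul_inv _ (Gamma (a / 2) * _ * (_ * _))]
    simp only [mul_inv]
    rw [mul_mul_mul_comm (Gamma ((a + 1) / 2))⁻¹, ka', kb', mul_mul_mul_comm (Gamma (a / 2))⁻¹,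
      ka, kb]
    rw [show Real.pi * (Real.pi / sin (Real.pi * e)) = Real.pi ^ 2 / sin (Real.pi * e) by ring]
    field_simp
    simpa only [mul_div_assoc] using hsin
  · have hc' : ∀ n : ℕ, 2 * c ≠ -(n : ℂ) := by
      rintro (_ | n) hn
      · simp [c0] at hn
      · exact hc n (by push_cast at hn; linear_combination hn)
    have hs : Summable (term32 a b c e (2 * c + 1)) := by
      refine summable_term32 he hc ?_
      rw [show e + (2 * c + 1) - a - b - c = c + 1 - e + 1 by linear_combination -hab, add_re,
        one_re]
      linarith
    have hk := hasSum_natCast_mul_term32 hab he hc h ha hb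
    have hw := watson_summation hab he hc' h
    have hterm : ∀ k : ℕ, term32 a b c e (2 * c) k = term32 a b c e (2 * c + 1) k +
        (2 * c)⁻¹ * (k * term32 a b c e (2 * c + 1) k) := by
      intro k
      have h3 : 2 * c * poch (2 * c + 1) k = poch (2 * c) k * (2 * c + k) := by
        rw [← poch_succ, poch_succ_left]
      have := poch_ne_zero hc k
      have := poch_ne_zero he k
      have := poch_ne_zero hc' k
      have : (k ! : ℂ) ≠ 0 := by exact_mod_cast k.factorial_ne_zero
      have h4 : (poch (2 * c) k)⁻¹ = (poch (2 * c + 1) k)⁻¹ * (1 + (2 * c)⁻¹ * k) := by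
        field_simp
        linear_combination h3
      rw [term32, term32]
      simp only [div_eq_mul_inv, mul_inv, h4]
      ring
    simp only [hterm] at hw
    rw [hs.tsum_add (hk.summable.mul_left _), tsum_mul_left, hk.tsum_eq,
      inv_mul_cancel_left₀ (by simpa using c0)] at hw
    rw [← hw, add_sub_cancel_right]

lemma hyp_eq_tsum_term32 (a b c e f : ℂ) {d : ℂ} (hd : ∀ n : ℕ, d ≠ -(n : ℂ)) :
    hyp [a, b, c, d + 1] [e, f, d] 1 =
      ∑' k : ℕ, (term32 a b c e f k + d⁻¹ * (k * term32 a b c e f k)) := by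
  refine tsum_congr fun k => ?_
  have h : d * poch (d + 1) k = poch d k * (d + k) := by rw [← poch_succ, poch_succ_left]
  have d0 : d ≠ 0 := by simpa using hd 0
  have hp := poch_ne_zero hd k
  have h2 : poch (d + 1) k / poch d k = 1 + d⁻¹ * k := by
    field_simp
    linear_combination h
  simp only [List.map_cons, List.map_nil, List.prod_cons, List.prod_nil, one_pow, mul_one]
  calc _ = term32 a b c e f k * (poch (d + 1) k / poch d k) := by
        rw [term32]
        simp only [div_eq_mul_inv, mul_inv]
        ring
    _ = _ := by
        rw [h2]
        ring

lemma Gamma_div_two_mul (a : ℂ) :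
    Gamma (a / 2) * Gamma ((a + 1) / 2) = Gamma a * 2 ^ (1 - a) * √Real.pi := by
  have h := Gamma_mul_Gamma_add_half (a / 2)
  rwa [show a / 2 + 1 / 2 = (a + 1) / 2 by ring, show 2 * (a / 2) = a by ring] at h

end

theorem extended_watson_summation (a b c d : ℂ) (hd : 0 < d.re)
    (hcab : -1 < (2 * c - a - b).re)
    (h1 : ∀ n : ℕ, (a + b + 1) / 2 ≠ -(n : ℂ))
    (h2 : ∀ n : ℕ, 2 * c + 1 ≠ -(n : ℂ))
    (ha : ∀ n : ℕ, a ≠ -(n : ℂ))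
    (hb : ∀ n : ℕ, b ≠ -(n : ℂ))
    (h3 : ∀ n : ℕ, c - a / 2 + 1/2 ≠ -(n : ℂ))
    (h4 : ∀ n : ℕ, c - b / 2 + 1/2 ≠ -(n : ℂ))
    (h5 : ∀ n : ℕ, c - a / 2 + 1 ≠ -(n : ℂ))
    (h6 : ∀ n : ℕ, c - b / 2 + 1 ≠ -(n : ℂ)) :
    hyp [a, b, c, d + 1] [(a + b + 1) / 2, 2 * c + 1, d] 1 =
      (2 : ℂ) ^ (a + b - 2) * Complex.Gamma (c + 1/2) *
        Complex.Gamma ((a + b + 1) / 2) * Complex.Gamma (c - (a + b) / 2 + 1/2) /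
        (Complex.Gamma (1/2) * Complex.Gamma a * Complex.Gamma b) *
        (Complex.Gamma (a / 2) * Complex.Gamma (b / 2) /
            (Complex.Gamma (c - a / 2 + 1/2) * Complex.Gamma (c - b / 2 + 1/2)) +
          ((2 * c - d) / d) * (Complex.Gamma ((a + 1) / 2) * Complex.Gamma ((b + 1) / 2)) /
            (Complex.Gamma (c - a / 2 + 1) * Complex.Gamma (c - b / 2 + 1))) := by
  have hd' : ∀ n : ℕ, d ≠ -(n : ℂ) := fun n hn => by
    rw [hn] at hd
    simp at hd
    linarith [n.cast_nonneg (α := ℝ)]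
  have a0 : a ≠ 0 := by simpa using ha 0
  have b0 : b ≠ 0 := by simpa using hb 0
  have d0 : d ≠ 0 := by simpa using hd' 0
  have hab : a + b + 1 = 2 * ((a + b + 1) / 2) := by ring
  have hre : 0 < (c + 1 - (a + b + 1) / 2).re := by
    rw [show c + 1 - (a + b + 1) / 2 = ((1 / 2 : ℝ) : ℂ) * (2 * c - a - b + 1) by
      push_cast; ring, Complex.re_ofReal_mul, Complex.add_re, Complex.one_re]
    linarith
  have hs : Summable (term32 a b c ((a + b + 1) / 2) (2 * c + 1)) := by
    refine summable_term32 h1 h2 ?_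
    rw [show (a + b + 1) / 2 + (2 * c + 1) - a - b - c = c + 1 - (a + b + 1) / 2 + 1 by ring,
      Complex.add_re, Complex.one_re]
    linarith
  have hk := hasSum_natCast_mul_term32 hab h1 h2 hre a0 b0
  rw [hyp_eq_tsum_term32 _ _ _ _ _ hd', hs.tsum_add (hk.summable.mul_left _), tsum_mul_left,
    hk.tsum_eq, tsum_term32_two_mul_add_one hab h1 h2 hre a0 b0, Gamma_one_half_eq_sqrt,
    show c - (a + b) / 2 + 1 / 2 = c + 1 - (a + b + 1) / 2 by ring]
  have hda := Gamma_div_two_mul a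
  have hdb := Gamma_div_two_mul b
  have hpow : (2 : ℂ) ^ (a + b - 2) = (2 ^ (1 - a))⁻¹ * (2 ^ (1 - b))⁻¹ := by
    rw [← Complex.cpow_neg, ← Complex.cpow_neg, ← Complex.cpow_add _ _ two_ne_zero]
    congr 1
    ring
  have n1 : Complex.Gamma (a / 2) ≠ 0 := Complex.Gamma_ne_zero fun n hn =>
    ha (2 * n) (by push_cast; linear_combination 2 * hn)
  have n2 : Complex.Gamma (b / 2) ≠ 0 := Complex.Gamma_ne_zero fun n hn =>
    hb (2 * n) (by push_cast; linear_combination 2 * hn)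
  have n3 : Complex.Gamma ((a + 1) / 2) ≠ 0 := Complex.Gamma_ne_zero fun n hn =>
    ha (2 * n + 1) (by push_cast; linear_combination 2 * hn)
  have n4 : Complex.Gamma ((b + 1) / 2) ≠ 0 := Complex.Gamma_ne_zero fun n hn =>
    hb (2 * n + 1) (by push_cast; linear_combination 2 * hn)
  have n5 := Complex.Gamma_ne_zero h3
  have n6 := Complex.Gamma_ne_zero h4
  have n7 := Complex.Gamma_ne_zero h5
  have n8 := Complex.Gamma_ne_zero h6
  have hπ : (√Real.pi : ℂ) ≠ 0 := by
    exact_mod_cast (Real.sqrt_pos.2 Real.pi_pos).ne'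
  have hpre : (2 : ℂ) ^ (a + b - 2) / (√Real.pi * Complex.Gamma a * Complex.Gamma b) =
      √Real.pi / (Complex.Gamma (a / 2) * Complex.Gamma ((a + 1) / 2) *
        (Complex.Gamma (b / 2) * Complex.Gamma ((b + 1) / 2))) := by
    have m1 : (2 : ℂ) ^ (1 - a) ≠ 0 := by simp [Complex.cpow_eq_zero_iff]
    have m2 : (2 : ℂ) ^ (1 - b) ≠ 0 := by simp [Complex.cpow_eq_zero_iff]
    have := Complex.Gamma_ne_zero ha
    have := Complex.Gamma_ne_zero hb
    rw [hda, hdb, hpow]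
    field_simp
  rw [mul_assoc (2 ^ _), mul_assoc (2 ^ _), mul_div_right_comm (2 ^ _), hpre]
  field_simp
  ring
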